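/- Let γ_0, ..., γ_D be real numbers and w ∈ ℝ^{D+1}. Then for every integer t ≥ 1: Σ_{d=0}^D w_d Φ_d(t) = Σ_{d=0}^D ( γ_d Σ_{j=d}^D w_j ) Φ_d(t − 1); equivalently, writing η(t) := Σ_{d=0}^D w_d Φ_d(t) and [f(η)](t) := Σ_{d=0}^D (Γ w)_d Φ_d(t), one has η(t) = [f(η)](t − 1). -/

import Mathlib

/-- `Phi γ d t = Σ_{(a_0,...,a_d) ∈ ℕ^{d+1}, a_0+...+a_d = t} ∏_{i=0}^{d} γ_i^{a_i}`. -/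
noncomputable def Phi (γ : ℕ → ℝ) (d t : ℕ) : ℝ :=
  ∑ a ∈ Finset.Nat.antidiagonalTuple (d + 1) t, ∏ i : Fin (d + 1), γ i ^ a i

/-- `Gam γ D` is the (D+1)×(D+1) matrix with `Γ_{ij} = γ_i` if `i ≤ j`, else `0`. -/
def Gam (γ : ℕ → ℝ) (D : ℕ) : Matrix (Fin (D + 1)) (Fin (D + 1)) ℝ :=
  Matrix.of fun i j => if i ≤ j then γ i else 0

theorem Phi_zero_left (γ : ℕ → ℝ) (t : ℕ) : Phi γ 0 t = γ 0 ^ t := by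
  simp [Phi, Finset.Nat.antidiagonalTuple_one]

theorem Phi_succ_succ (γ : ℕ → ℝ) (d s : ℕ) :
    Phi γ (d + 1) (s + 1) = γ (d + 1) * Phi γ (d + 1) s + Phi γ d (s + 1) := by
  unfold Phi
  rw [← Finset.sum_filter_not_add_sum_filter _
    (fun a : Fin (d + 1 + 1) → ℕ => a (Fin.last (d + 1)) = 0), Finset.mul_sum]
  congr 1
  · refine Finset.sum_bij'
      (fun a _ => Fin.snoc (α := fun _ => ℕ) (Fin.init a) (a (Fin.last (d + 1)) - 1))
      (fun a _ => Fin.snoc (α := fun _ => ℕ) (Fin.init a) (a (Fin.last (d + 1)) + 1))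
      ?_ ?_ ?_ ?_ ?_
    · intro a ha
      simp only [Finset.mem_filter, Finset.Nat.mem_antidiagonalTuple, Fin.sum_univ_castSucc,
        Fin.snoc_castSucc, Fin.snoc_last, Fin.init] at ha ⊢
      omega
    · intro a ha
      simp only [Finset.mem_filter, Finset.Nat.mem_antidiagonalTuple, Fin.sum_univ_castSucc,
        Fin.snoc_castSucc, Fin.snoc_last, Fin.init] at ha ⊢
      omega
    · intro a ha
      have h : a (Fin.last (d + 1)) - 1 + 1 = a (Fin.last (d + 1)) :=
        Nat.sub_add_cancel (Nat.pos_of_ne_zero (Finset.mem_filter.mp ha).2)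
      simp [h]
    · intro a _
      simp
    · intro a ha
      obtain ⟨n, hn⟩ := Nat.exists_eq_succ_of_ne_zero (Finset.mem_filter.mp ha).2
      simp only [Fin.prod_univ_castSucc (n := d + 1), Fin.snoc_castSucc, Fin.snoc_last, Fin.init,
        hn, Fin.val_last, Fin.val_castSucc, Nat.succ_eq_add_one, Nat.add_sub_cancel, pow_succ]
      ring
  · refine Finset.sum_bij' (fun a _ => Fin.init a)
      (fun a _ => Fin.snoc (α := fun _ => ℕ) a 0) ?_ ?_ ?_ ?_ ?_
    · intro a ha
      simp only [Finset.mem_filter, Finset.Nat.mem_antidiagonalTuple,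
        Fin.sum_univ_castSucc (n := d + 1), Fin.init] at ha ⊢
      omega
    · intro a ha
      simp only [Finset.mem_filter, Finset.Nat.mem_antidiagonalTuple,
        Fin.sum_univ_castSucc (n := d + 1), Fin.snoc_castSucc, Fin.snoc_last] at ha ⊢
      exact ⟨ha, trivial⟩
    · intro a ha
      rw [← (Finset.mem_filter.mp ha).2, Fin.snoc_init_self]
    · intro a _
      simp
    · intro a ha
      simp [Fin.prod_univ_castSucc (n := d + 1), (Finset.mem_filter.mp ha).2, Fin.init]

theorem Phi_succ_right (γ : ℕ → ℝ) (d s : ℕ) :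
    Phi γ d (s + 1) = ∑ i ∈ Finset.range (d + 1), γ i * Phi γ i s := by
  induction d with
  | zero => simp [Phi_zero_left, pow_succ']
  | succ d ih => rw [Phi_succ_succ, ih, Finset.sum_range_succ _ (d + 1), add_comm]

theorem Gam_mulVec (γ : ℕ → ℝ) (D : ℕ) (w : Fin (D + 1) → ℝ) (d : Fin (D + 1)) :
    (Gam γ D).mulVec w d = γ d * ∑ j ∈ Finset.Icc d (Fin.last D), w j := by
  have h : Finset.Icc d (Fin.last D) = Finset.univ.filter (d ≤ ·) := by
    ext j
    simp [Fin.le_last]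
  simp [Matrix.mulVec, dotProduct, Gam, h, Finset.mul_sum, Finset.sum_filter]

theorem sum_mul_Phi_succ (γ : ℕ → ℝ) (D : ℕ) (w : Fin (D + 1) → ℝ) (s : ℕ) :
    ∑ d : Fin (D + 1), w d * Phi γ d (s + 1)
      = ∑ d : Fin (D + 1), (γ d * ∑ j ∈ Finset.Icc d (Fin.last D), w j) * Phi γ d s := by
  have h (d : Fin (D + 1)) :
      Phi γ d (s + 1) = ∑ i ∈ Finset.Iic d, γ i * Phi γ i s := by
    rw [Phi_succ_right, Nat.range_succ_eq_Iic, ← Fin.map_valEmbedding_Iic, Finset.sum_map]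
    rfl
  simp only [h, Finset.mul_sum, Finset.sum_mul]
  rw [Finset.sum_comm' (t' := Finset.univ) (s' := fun i => Finset.Icc i (Fin.last D))
    (by simp [Fin.le_last])]
  refine Finset.sum_congr rfl fun i _ => Finset.sum_congr rfl fun j _ => ?_
  ring

/-- for `t ≥ 1`,
`Σ_{d=0}^D w_d Φ_d(t) = Σ_{d=0}^D (γ_d Σ_{j=d}^D w_j) Φ_d(t-1)`; equivalently,
writing `η(t) = Σ_d w_d Φ_d(t)` and `[f(η)](t) = Σ_d (Γ w)_d Φ_d(t)`, `η(t) = [f(η)](t-1)`. -/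
theorem stmt7 (γ : ℕ → ℝ) (D : ℕ) (w : Fin (D + 1) → ℝ) (t : ℕ) (ht : 1 ≤ t) :
    (∑ d : Fin (D + 1), w d * Phi γ d t
      = ∑ d : Fin (D + 1), (γ d * ∑ j ∈ Finset.Icc d (Fin.last D), w j) * Phi γ d (t - 1)) ∧
    (∑ d : Fin (D + 1), w d * Phi γ d t
      = ∑ d : Fin (D + 1), ((Gam γ D).mulVec w) d * Phi γ d (t - 1)) := by
  obtain ⟨s, rfl⟩ := Nat.exists_eq_add_of_le' ht
  simp only [Nat.add_sub_cancel, Gam_mulVec, and_self]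
  exact sum_mul_Phi_succ γ D w s
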